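/- For every real number x with |x| < 2*pi/(3*sqrt(3)), the series sum over n >= 1 of d(n,0) x^n / n! converges and its sum equals ((sqrt(3)/6) * sin(sqrt(3) x + pi/3) + x/2 - 1/4) / (cos((sqrt(3)/2) x + pi/6))^2, where d(n,0) is the total number of leaves in all plane 1-2 trees on [n]. -/

import Mathlib

namespace BalancedTrees

/-- Plane binary trees with vertices labeled by natural numbers;
`nil` is the empty tree, and each child of a vertex is designated
as a left child or a right child. -/
inductive BT where
  | nil : BT
  | node (label : ℕ) (l r : BT) : BT
deriving DecidableEq

namespace BT

/-- `balRank t = some k` if and only if the root of `t` is a balanced vertex of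
rank `k`, i.e. every descending path from the root to a leaf has length `k`. -/
def balRank : BT → Option ℕ
  | .nil => none
  | .node _ .nil .nil => some 0
  | .node _ .nil (.node b rl rr) => (balRank (BT.node b rl rr)).map (· + 1)
  | .node _ (.node a ll lr) .nil => (balRank (BT.node a ll lr)).map (· + 1)
  | .node _ (.node a ll lr) (.node b rl rr) =>
      match balRank (BT.node a ll lr), balRank (BT.node b rl rr) with
      | some i, some j => if i = j then some (i + 1) else none
      | _, _ => none

/-- The number of balanced vertices of rank `k` in the tree `t`. -/
def countBal (k : ℕ) : BT → ℕ
  | .nil => 0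
  | .node v l r =>
      countBal k l + countBal k r +
        (if balRank (BT.node v l r) = some k then 1 else 0)

/-- The number of balanced vertices (of any rank) in the tree `t`. -/
def countBalAll : BT → ℕ
  | .nil => 0
  | .node v l r =>
      countBalAll l + countBalAll r +
        (if (balRank (BT.node v l r)).isSome then 1 else 0)

/-- Auxiliary, fuelled version of `treeOf`. -/
def treeOfAux : ℕ → List ℕ → BT
  | 0, _ => .nil
  | _ + 1, [] => .nil
  | fuel + 1, l =>
      let m := l.foldr max 0
      BT.node m (treeOfAux fuel (l.takeWhile (· != m)))
                (treeOfAux fuel ((l.dropWhile (· != m)).tail))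

/-- The decreasing binary tree `T(π)` of a sequence `π` of distinct labels:
the root is the maximum entry, and its left (resp. right) subtree is built
recursively from the part of the sequence to the left (resp. right) of the
maximum. This is a bijection between permutations of `{1,…,n}` and
decreasing binary trees on `{1,…,n}`. -/
def treeOf (l : List ℕ) : BT := treeOfAux l.length l

/-- Canonical form for non-plane 1-2 trees (as represented by plane trees):
an only child is stored as a left child, and of two (unordered) children the
one with the larger label is stored on the left. Decreasing binary trees in
canonical form are in bijection with non-plane 1-2 trees. -/
def canonNP : BT → Bool
  | .nil => true
  | .node _ l r =>
      canonNP l && canonNP r &&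
        (match l, r with
         | .nil, .nil => true
         | .node _ _ _, .nil => true
         | .nil, .node _ _ _ => false
         | .node a _ _, .node b _ _ => decide (b < a))

/-- Canonical form for plane 1-2 trees: an only child is stored as a left
child (an only child carries no left/right designation), while two children
remain ordered. Decreasing binary trees in canonical form are in bijection
with plane 1-2 trees. -/
def canonP : BT → Bool
  | .nil => true
  | .node _ l r =>
      canonP l && canonP r &&
        (match l, r with
         | .nil, .node _ _ _ => false
         | _, _ => true)

end BT

open BT

/-- The list of all permutations of `{1,…,n}`, each written as a list. -/
def perms (n : ℕ) : List (List ℕ) := (List.range' 1 n).permutations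

/-- `a n k`: the total number of balanced vertices of rank `k` over all
decreasing binary trees on `{1,…,n}`. -/
def a (n k : ℕ) : ℕ := ((perms n).map fun l => countBal k (treeOf l)).sum

/-- `r n k`: the number of decreasing binary trees on `{1,…,n}` whose root is
balanced of rank `k`. -/
def r (n k : ℕ) : ℕ :=
  ((perms n).filter fun l => decide (balRank (treeOf l) = some k)).length

/-- `p n k`: the probability that the root of a uniformly random decreasing
binary tree on `{1,…,n}` is balanced of rank `k`; by convention `p 0 k = 1`. -/
def p (n k : ℕ) : ℚ := if n = 0 then 1 else (r n k : ℚ) / (Nat.factorial n : ℚ)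

/-- The number of decreasing binary trees on `{1,…,n}` whose root is balanced. -/
def rootBal (n : ℕ) : ℕ :=
  ((perms n).filter fun l => (balRank (treeOf l)).isSome).length

/-- `proot n`: the probability that the root of a uniformly random decreasing
binary tree on `{1,…,n}` is balanced. -/
def proot (n : ℕ) : ℚ := (rootBal n : ℚ) / (Nat.factorial n : ℚ)

/-- The total number of balanced vertices over all decreasing binary trees
on `{1,…,n}`. -/
def totalBal (n : ℕ) : ℕ := ((perms n).map fun l => countBalAll (treeOf l)).sum

/-- `Pbal n`: the probability that a vertex chosen uniformly at random from
the `n * n!` vertices of all decreasing binary trees on `{1,…,n}` is balanced. -/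
def Pbal (n : ℕ) : ℚ := (totalBal n : ℚ) / ((n : ℚ) * (Nat.factorial n : ℚ))

/-- Permutations whose decreasing binary tree is a canonical representative
of a non-plane 1-2 tree; these are in bijection with non-plane 1-2 trees
on `{1,…,n}`. -/
def npPerms (n : ℕ) : List (List ℕ) := (perms n).filter fun l => canonNP (treeOf l)

/-- `E n`: the number of non-plane 1-2 trees on `{1,…,n}` (the Euler number). -/
def E (n : ℕ) : ℕ := (npPerms n).length

/-- `b n k`: the total number of balanced vertices of rank `k` over all
non-plane 1-2 trees on `{1,…,n}`. -/
def b (n k : ℕ) : ℕ := ((npPerms n).map fun l => countBal k (treeOf l)).sum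

/-- `s n k`: the number of non-plane 1-2 trees on `{1,…,n}` whose root is
balanced of rank `k`. -/
def s (n k : ℕ) : ℕ :=
  ((npPerms n).filter fun l => decide (balRank (treeOf l) = some k)).length

/-- Permutations whose decreasing binary tree is a canonical representative
of a plane 1-2 tree; these are in bijection with plane 1-2 trees on `{1,…,n}`. -/
def pPerms (n : ℕ) : List (List ℕ) := (perms n).filter fun l => canonP (treeOf l)

/-- `z n`: the number of plane 1-2 trees on `{1,…,n}`. -/
def z (n : ℕ) : ℕ := (pPerms n).length

/-- `d n k`: the total number of balanced vertices of rank `k` over all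
plane 1-2 trees on `{1,…,n}`. -/
def d (n k : ℕ) : ℕ := ((pPerms n).map fun l => countBal k (treeOf l)).sum

/-- `t n k`: the number of plane 1-2 trees on `{1,…,n}` whose root is
balanced of rank `k`. -/
def t (n k : ℕ) : ℕ :=
  ((pPerms n).filter fun l => decide (balRank (treeOf l) = some k)).length

end BalancedTrees

namespace BalancedTrees

open Finset BT

/-- The lists enumerating the finite set `S` without repetition. -/
noncomputable def orderings (S : Finset ℕ) : Finset (List ℕ) := S.toList.permutations.toFinset

theorem mem_orderings {S : Finset ℕ} {l : List ℕ} :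
    l ∈ orderings S ↔ l.Nodup ∧ ∀ x, x ∈ l ↔ x ∈ S := by
  simp only [orderings, List.mem_toFinset, List.mem_permutations]
  constructor
  · intro h
    exact ⟨h.nodup_iff.2 S.nodup_toList, fun x => by rw [h.mem_iff, mem_toList]⟩
  · rintro ⟨hl, h⟩
    exact (List.perm_ext_iff_of_nodup hl S.nodup_toList).2 fun x => by rw [h, mem_toList]

theorem orderings_empty : orderings ∅ = {[]} := by
  simp [orderings]

theorem foldr_max_le {m : ℕ} : ∀ {l : List ℕ}, (∀ x ∈ l, x ≤ m) → l.foldr max 0 ≤ m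
  | [], _ => Nat.zero_le m
  | a :: l, h => by
    simp only [List.foldr_cons, max_le_iff]
    exact ⟨h a (by simp), foldr_max_le fun x hx => h x (by simp [hx])⟩

theorem le_foldr_max {m : ℕ} : ∀ {l : List ℕ}, m ∈ l → m ≤ l.foldr max 0
  | a :: l, h => by
    rw [List.foldr_cons]
    rcases List.mem_cons.1 h with rfl | h
    · exact le_max_left _ _
    · exact (le_foldr_max h).trans (le_max_right _ _)

theorem treeOfAux_append_cons {A B : List ℕ} {m : ℕ} (hA : ∀ x ∈ A, x < m)
    (hB : ∀ x ∈ B, x < m) (n : ℕ) :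
    treeOfAux (n + 1) (A ++ m :: B) = BT.node m (treeOfAux n A) (treeOfAux n B) := by
  have hmax : (A ++ m :: B).foldr max 0 = m := by
    refine le_antisymm (foldr_max_le fun x hx => ?_) (le_foldr_max (by simp))
    rcases List.mem_append.1 hx with h | h
    · exact (hA x h).le
    · rcases List.mem_cons.1 h with h | h
      · exact h.le
      · exact (hB x h).le
  have hA' : ∀ x ∈ A, (x != m) = true := fun x hx => by simpa using (hA x hx).ne
  have hne : A ++ m :: B ≠ [] := by simp
  rw [treeOfAux.eq_3 _ _ (fun h => hne h), hmax]
  simp [List.takeWhile_append_of_pos hA', List.dropWhile_append_of_pos hA']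

theorem exists_eq_append_cons {l : List ℕ} (hl : l.Nodup) (hne : l ≠ []) :
    ∃ A m B, l = A ++ m :: B ∧ (∀ x ∈ A, x < m) ∧ ∀ x ∈ B, x < m := by
  have hS : l.toFinset.Nonempty := by simpa using hne
  obtain ⟨A, B, h⟩ := List.append_of_mem (List.mem_toFinset.1 (l.toFinset.max'_mem hS))
  have hle : ∀ x ∈ l, x ≤ l.toFinset.max' hS := fun x hx =>
    le_max' _ _ (List.mem_toFinset.2 hx)
  generalize l.toFinset.max' hS = m at h hle
  subst h
  rw [List.nodup_middle, List.nodup_cons] at hl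
  refine ⟨A, m, B, rfl, fun x hx => lt_of_le_of_ne (hle x (by simp [hx])) ?_,
    fun x hx => lt_of_le_of_ne (hle x (by simp [hx])) ?_⟩
  · rintro rfl
    exact hl.1 (by simp [hx])
  · rintro rfl
    exact hl.1 (by simp [hx])

theorem treeOfAux_eq_treeOf (n : ℕ) :
    ∀ {l : List ℕ}, l.Nodup → l.length ≤ n → treeOfAux n l = treeOf l := by
  induction n using Nat.strong_induction_on with
  | _ n ih =>
    intro l hl hn
    rcases eq_or_ne l [] with rfl | hne
    · cases n <;> rfl
    · obtain ⟨A, m, B, rfl, hA, hB⟩ := exists_eq_append_cons hl hne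
      have hlen : (A ++ m :: B).length = (A.length + B.length) + 1 := by
        simp [Nat.add_assoc]
      obtain ⟨k, rfl⟩ : ∃ k, n = k + 1 := ⟨n - 1, by omega⟩
      have hnA : A.Nodup := (List.nodup_append.1 hl).1
      have hnB : B.Nodup := (List.nodup_cons.1 (List.nodup_append.1 hl).2.1).2
      rw [treeOf, hlen, treeOfAux_append_cons hA hB, treeOfAux_append_cons hA hB,
        ih k (by omega) hnA (by omega), ih k (by omega) hnB (by omega),
        ih (A.length + B.length) (by omega) hnA (by omega),
        ih (A.length + B.length) (by omega) hnB (by omega)]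

theorem treeOf_append_cons {A B : List ℕ} {m : ℕ} (hnA : A.Nodup) (hnB : B.Nodup)
    (hA : ∀ x ∈ A, x < m) (hB : ∀ x ∈ B, x < m) :
    treeOf (A ++ m :: B) = BT.node m (treeOf A) (treeOf B) := by
  have hlen : (A ++ m :: B).length = (A.length + B.length) + 1 := by
    simp [Nat.add_assoc]
  rw [treeOf, hlen, treeOfAux_append_cons hA hB, treeOfAux_eq_treeOf _ hnA (by omega),
    treeOfAux_eq_treeOf _ hnB (by omega)]

variable {R : Type*} [CommSemiring R]

/-- The sum of the weight `φ` over all decreasing binary trees with label set `S`. -/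
noncomputable def treeSum (φ : BT → R) (S : Finset ℕ) : R := ∑ l ∈ orderings S, φ (treeOf l)

theorem treeSum_empty (φ : BT → R) : treeSum φ ∅ = φ .nil := by
  simp [treeSum, orderings_empty, treeOf, treeOfAux]

theorem treeSum_insert_eq_sum_sigma {S : Finset ℕ} {m : ℕ} (hm : ∀ x ∈ S, x < m)
    (φ : BT → R) :
    treeSum φ (insert m S) = ∑ p ∈ S.powerset.sigma
      fun T => orderings T ×ˢ orderings (S \ T),
        φ (BT.node m (treeOf p.2.1) (treeOf p.2.2)) := by
  symm
  refine sum_nbij (fun p => p.2.1 ++ m :: p.2.2) ?_ ?_ ?_ ?_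
  · rintro ⟨T, A, B⟩ h
    simp only [mem_sigma, mem_powerset, mem_product, mem_orderings, mem_sdiff] at h ⊢
    obtain ⟨hT, ⟨hA, hAT⟩, hB, hBT⟩ := h
    have hmS : m ∉ S := fun h => (hm m h).false
    constructor
    · rw [List.nodup_middle, List.nodup_cons]
      refine ⟨?_, List.nodup_append'.2 ⟨hA, hB, fun x hx hx' => ?_⟩⟩
      · rw [List.mem_append, hAT, hBT]
        rintro (h | h)
        · exact hmS (hT h)
        · exact hmS h.1
      · exact ((hBT x).1 hx').2 ((hAT x).1 hx)
    · intro x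
      have := @hT x
      simp only [List.mem_append, List.mem_cons, mem_insert, hAT, hBT]
      tauto
  · rintro ⟨T, A, B⟩ h ⟨T', A', B'⟩ h' heq
    simp only [coe_sigma, Set.mem_sigma_iff, mem_coe, mem_powerset, mem_product, mem_orderings,
      mem_sdiff] at h h' heq
    obtain ⟨hT, ⟨-, hAT⟩, -, hBT⟩ := h
    obtain ⟨hT', ⟨-, hAT'⟩, -, hBT'⟩ := h'
    have hmS : m ∉ S := fun h => (hm m h).false
    obtain ⟨rfl, -, rfl⟩ := (List.append_cons_inj_of_notMem
      (fun h => hmS (hT ((hAT m).1 h))) (fun h => hmS ((hBT m).1 h).1)).1 heq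
    obtain rfl : T = T' := by
      ext x
      rw [← hAT, ← hAT']
    rfl
  · intro l hl
    simp only [mem_coe, mem_orderings] at hl
    obtain ⟨hnd, hl⟩ := hl
    obtain ⟨A, B, rfl⟩ := List.append_of_mem ((hl m).2 (mem_insert_self m S))
    rw [List.nodup_middle, List.nodup_cons, List.nodup_append'] at hnd
    obtain ⟨hmAB, hA, hB, hd⟩ := hnd
    simp only [List.mem_append, List.mem_cons, mem_insert, not_or] at hl hmAB
    refine ⟨⟨A.toFinset, A, B⟩, ?_, rfl⟩
    simp only [coe_sigma, Set.mem_sigma_iff, mem_coe, mem_powerset, mem_product, mem_orderings,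
      mem_sdiff, List.mem_toFinset]
    refine ⟨fun x hx => ?_, ⟨hA, fun _ => trivial⟩, hB, fun x => ?_⟩
    · rw [List.mem_toFinset] at hx
      exact ((hl x).1 (Or.inl hx)).resolve_left fun h => hmAB.1 (h ▸ hx)
    · have h1 := hl x
      have h2 : x ∈ A → ¬ x ∈ B := fun h h' => hd h h'
      have h3 : x ∈ B → x ≠ m := fun h h' => hmAB.2 (h' ▸ h)
      have h4 : x ∈ S → x ≠ m := fun h => (hm x h).ne
      tauto
  · rintro ⟨T, A, B⟩ h
    simp only [mem_sigma, mem_powerset, mem_product, mem_orderings, mem_sdiff] at h ⊢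
    obtain ⟨hT, ⟨hA, hAT⟩, hB, hBT⟩ := h
    rw [treeOf_append_cons hA hB (fun x hx => hm x (hT ((hAT x).1 hx)))
      fun x hx => hm x ((hBT x).1 hx).1]

theorem sum_sigma_mul {S : Finset ℕ} {φ ψ : BT → R} {f g : ℕ → R}
    (hf : ∀ T ⊆ S, treeSum φ T = f #T) (hg : ∀ T ⊆ S, treeSum ψ T = g #T) :
    ∑ p ∈ S.powerset.sigma fun T => orderings T ×ˢ orderings (S \ T),
        φ (treeOf p.2.1) * ψ (treeOf p.2.2) =
      ∑ i ∈ range (#S + 1), ((#S).choose i : R) * f i * g (#S - i) := by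
  rw [sum_sigma]
  have : ∀ T ∈ S.powerset, (∑ p ∈ orderings T ×ˢ orderings (S \ T),
      φ (treeOf p.1) * ψ (treeOf p.2)) = f #T * g (#S - #T) := by
    intro T hT
    rw [mem_powerset] at hT
    rw [sum_product]
    dsimp only
    rw [← sum_mul_sum, ← card_sdiff_of_subset hT, ← hf T hT, ← hg _ sdiff_subset]
    rfl
  rw [sum_congr rfl this, sum_powerset_apply_card fun i => f i * g (#S - i)]
  simp only [nsmul_eq_mul, mul_assoc]

/-- The indicator of the empty tree. -/
def nilWeight : BT → R
  | .nil => 1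
  | .node _ _ _ => 0

/-- The indicator of the nonempty canonical trees. -/
def canonWeight : BT → R
  | .nil => 0
  | .node v l r => if canonP (.node v l r) then 1 else 0

/-- The number of leaves of a tree if it is canonical, and zero otherwise. -/
def leafWeight (t : BT) : R := if canonP t then (countBal 0 t : R) else 0

theorem canonWeight_node (v : ℕ) (l r : BT) :
    (canonWeight (.node v l r) : R) =
      nilWeight l * nilWeight r + canonWeight l * nilWeight r +
        canonWeight l * canonWeight r := by
  cases l <;> cases r <;> simp [canonWeight, nilWeight, canonP, ← ite_and, and_comm]

theorem leafWeight_node (v : ℕ) (l r : BT) :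
    (leafWeight (.node v l r) : R) =
      nilWeight l * nilWeight r + leafWeight l * nilWeight r +
        leafWeight l * canonWeight r + canonWeight l * leafWeight r := by
  cases l with
  | nil => cases r <;> simp [leafWeight, canonWeight, nilWeight, canonP, countBal, balRank]
  | node a ll lr =>
    cases r with
    | nil =>
      have h : balRank (.node v (.node a ll lr) .nil) ≠ some 0 := by
        simp [balRank]
      rw [leafWeight, countBal, if_neg h]
      simp [leafWeight, canonWeight, nilWeight, canonP, countBal]
    | node b rl rr =>
      have h : balRank (.node v (.node a ll lr) (.node b rl rr)) ≠ some 0 := by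
        rw [balRank]
        split
        · split <;> simp
        · simp
      rw [leafWeight, countBal, if_neg h]
      generalize hL : BT.node a ll lr = L
      generalize hR : BT.node b rl rr = R'
      have hc : canonP (.node v L R') = (canonP L && canonP R') := by
        subst hL hR; simp [canonP]
      have hL' : (canonWeight L : R) = if canonP L then 1 else 0 := by subst hL; rfl
      have hR'' : (canonWeight R' : R) = if canonP R' then 1 else 0 := by subst hR; rfl
      have hn : (nilWeight R' : R) = 0 := by subst hR; rfl
      rw [hc, hL', hR'', hn, leafWeight, leafWeight]
      cases canonP L <;> cases canonP R' <;> simp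

theorem treeSum_nilWeight (S : Finset ℕ) :
    treeSum (nilWeight : BT → R) S = (Pi.single 0 1 : ℕ → R) #S := by
  rcases S.eq_empty_or_nonempty with rfl | hS
  · simp [treeSum_empty, nilWeight]
  · rw [Pi.single_eq_of_ne hS.card_ne_zero]
    refine sum_eq_zero fun l hl => ?_
    rw [mem_orderings] at hl
    obtain ⟨x, hx⟩ := hS
    obtain ⟨A, m, B, rfl, hA, hB⟩ := exists_eq_append_cons hl.1
      (List.ne_nil_of_mem ((hl.2 x).2 hx))
    rw [treeOf, List.length_append, List.length_cons, ← Nat.add_assoc,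
      treeOfAux_append_cons hA hB, nilWeight]

theorem sum_choose_mul_single (f : ℕ → R) (n : ℕ) :
    ∑ i ∈ range (n + 1), (n.choose i : R) * f i * (Pi.single 0 1 : ℕ → R) (n - i) = f n := by
  rw [sum_range_succ, sum_eq_zero]
  · simp
  · intro i hi
    rw [mem_range] at hi
    simp [Nat.sub_ne_zero_of_lt hi]

theorem strong_induction_on_max {P : Finset ℕ → Prop} (S : Finset ℕ) (h0 : P ∅)
    (h : ∀ (S : Finset ℕ) (m : ℕ), (∀ x ∈ S, x < m) → (∀ T ⊆ S, P T) → P (insert m S)) :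
    P S := by
  induction S using Finset.strongInduction with
  | H S ih =>
    rcases S.eq_empty_or_nonempty with rfl | hS
    · exact h0
    · rw [← insert_erase (S.max'_mem hS)]
      exact h _ _ (fun x hx => lt_max'_of_mem_erase_max' _ hS hx) fun T hT =>
        ih T (hT.trans_ssubset (erase_ssubset (S.max'_mem hS)))

theorem treeSum_canonWeight {a : ℕ → R} (ha0 : a 0 = 0)
    (ha : ∀ n, a (n + 1) = (Pi.single 0 1 : ℕ → R) n + a n +
      ∑ i ∈ range (n + 1), (n.choose i : R) * a i * a (n - i)) (S : Finset ℕ) :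
    treeSum (canonWeight : BT → R) S = a #S := by
  induction S using strong_induction_on_max with
  | h0 => simp [treeSum_empty, canonWeight, ha0]
  | h S m hm ih =>
    have hmS : m ∉ S := fun h => (hm m h).false
    have hnil := fun T (_ : T ⊆ S) => treeSum_nilWeight (R := R) T
    rw [card_insert_of_notMem hmS, ha, treeSum_insert_eq_sum_sigma hm]
    simp only [canonWeight_node, sum_add_distrib]
    rw [sum_sigma_mul hnil hnil,
      sum_sigma_mul ih hnil, sum_sigma_mul ih ih,
      sum_choose_mul_single, sum_choose_mul_single]

theorem treeSum_leafWeight {a b : ℕ → R} (ha0 : a 0 = 0)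
    (ha : ∀ n, a (n + 1) = (Pi.single 0 1 : ℕ → R) n + a n +
      ∑ i ∈ range (n + 1), (n.choose i : R) * a i * a (n - i))
    (hb0 : b 0 = 0)
    (hb : ∀ n, b (n + 1) = (Pi.single 0 1 : ℕ → R) n + b n +
      ∑ i ∈ range (n + 1), (n.choose i : R) * b i * a (n - i) +
      ∑ i ∈ range (n + 1), (n.choose i : R) * a i * b (n - i)) (S : Finset ℕ) :
    treeSum (leafWeight : BT → R) S = b #S := by
  induction S using strong_induction_on_max with
  | h0 => simp [treeSum_empty, leafWeight, countBal, hb0]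
  | h S m hm ih =>
    have hmS : m ∉ S := fun h => (hm m h).false
    have hnil := fun T (_ : T ⊆ S) => treeSum_nilWeight (R := R) T
    have hcanon := fun T (_ : T ⊆ S) => treeSum_canonWeight ha0 ha T
    rw [card_insert_of_notMem hmS, hb, treeSum_insert_eq_sum_sigma hm]
    simp only [leafWeight_node, sum_add_distrib]
    rw [sum_sigma_mul hnil hnil,
      sum_sigma_mul ih hnil, sum_sigma_mul ih hcanon,
      sum_sigma_mul hcanon ih, sum_choose_mul_single, sum_choose_mul_single]

theorem cast_d_zero_eq_treeSum (n : ℕ) :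
    (d n 0 : R) = treeSum (leafWeight : BT → R) (Icc 1 n) := by
  have hnd : (perms n).Nodup := List.nodup_permutations _ List.nodup_range'
  have hperms : (perms n).toFinset = orderings (Icc 1 n) := by
    ext l
    rw [List.mem_toFinset, mem_orderings, perms, List.mem_permutations]
    have hmem : ∀ x, x ∈ List.range' 1 n ↔ x ∈ Icc 1 n := fun x => by
      rw [List.mem_range'_1, mem_Icc]
      omega
    constructor
    · intro h
      exact ⟨h.nodup_iff.2 List.nodup_range', fun x => by rw [h.mem_iff, hmem]⟩
    · rintro ⟨hl, h⟩
      exact (List.perm_ext_iff_of_nodup hl List.nodup_range').2 fun x => by rw [h, hmem]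
  rw [d, pPerms, ← List.sum_toFinset _ (hnd.filter _), List.toFinset_filter, hperms, sum_filter,
    Nat.cast_sum, treeSum]
  refine sum_congr rfl fun l _ => ?_
  rw [leafWeight]
  split <;> simp

/-- The exponential generating function of nonempty plane 1-2 trees. -/
noncomputable def treeEGF (w : ℂ) : ℂ :=
  -(1 / 2) + (√3 : ℂ) / 2 *
    (Complex.sin ((√3 : ℂ) / 2 * w + Real.pi / 6) / Complex.cos ((√3 : ℂ) / 2 * w + Real.pi / 6))

/-- The exponential generating function of the number of leaves in plane 1-2 trees. -/
noncomputable def leafEGF (w : ℂ) : ℂ :=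
  ((√3 : ℂ) / 6 * Complex.sin ((√3 : ℂ) * w + Real.pi / 3) + w / 2 - 1 / 4) /
    Complex.cos ((√3 : ℂ) / 2 * w + Real.pi / 6) ^ 2

theorem sqrt_three_sq : (√3 : ℂ) ^ 2 = 3 := by
  rw [← Complex.ofReal_pow, Real.sq_sqrt (by norm_num)]
  norm_num

theorem cos_ne_zero_of_norm_lt {w : ℂ} (hw : ‖w‖ < 2 * Real.pi / (3 * √3)) :
    Complex.cos ((√3 : ℂ) / 2 * w + Real.pi / 6) ≠ 0 := by
  intro h
  obtain ⟨k, hk⟩ := Complex.cos_eq_zero_iff.1 h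
  have hre := congrArg Complex.re hk
  have hkr : (2 * (k : ℂ) + 1) * Real.pi / 2 = (((2 * k + 1) * Real.pi / 2 : ℝ) : ℂ) := by
    push_cast; ring
  have hlr : (√3 : ℂ) / 2 * w + Real.pi / 6 =
      ((√3 / 2 : ℝ) : ℂ) * w + ((Real.pi / 6 : ℝ) : ℂ) := by
    push_cast; ring
  rw [hkr, hlr, Complex.ofReal_re, Complex.add_re, Complex.re_ofReal_mul, Complex.ofReal_re] at hre
  have habs := (Complex.abs_re_le_norm w).trans_lt hw
  rw [lt_div_iff₀ (by positivity)] at habs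
  have hw3 : w.re * (3 * √3) = (3 * (k : ℝ) + 1) * (2 * Real.pi) := by linarith
  have hw3' := congrArg abs hw3
  rw [abs_mul w.re, abs_mul (3 * (k : ℝ) + 1), abs_of_pos (show 0 < 3 * √3 by positivity),
    abs_of_pos (show 0 < 2 * Real.pi by positivity)] at hw3'
  rw [hw3'] at habs
  have h1 : (1 : ℝ) ≤ |3 * (k : ℝ) + 1| := by
    have : (1 : ℤ) ≤ |3 * k + 1| := Int.one_le_abs (by omega)
    exact_mod_cast this
  nlinarith [Real.pi_pos]

theorem hasDerivAt_treeEGF {w : ℂ} (hw : Complex.cos ((√3 : ℂ) / 2 * w + Real.pi / 6) ≠ 0) :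
    HasDerivAt treeEGF (1 + treeEGF w + treeEGF w * treeEGF w) w := by
  have hu : HasDerivAt (fun w : ℂ => (√3 : ℂ) / 2 * w + Real.pi / 6) ((√3 : ℂ) / 2) w := by
    simpa using ((hasDerivAt_id w).const_mul ((√3 : ℂ) / 2)).add_const ((Real.pi : ℂ) / 6)
  have h : HasDerivAt treeEGF _ w :=
    ((hu.csin.div hu.ccos hw).const_mul ((√3 : ℂ) / 2)).const_add (-(1 / 2))
  convert h using 1
  simp only [treeEGF]
  generalize (√3 : ℂ) / 2 * w + Real.pi / 6 = u at hw
  field_simp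
  linear_combination (-(Complex.cos u ^ 2)) * sqrt_three_sq

theorem hasDerivAt_leafEGF {w : ℂ} (hw : Complex.cos ((√3 : ℂ) / 2 * w + Real.pi / 6) ≠ 0) :
    HasDerivAt leafEGF
      (1 + leafEGF w + leafEGF w * treeEGF w + treeEGF w * leafEGF w) w := by
  have hu : HasDerivAt (fun w : ℂ => (√3 : ℂ) / 2 * w + Real.pi / 6) ((√3 : ℂ) / 2) w := by
    simpa using ((hasDerivAt_id w).const_mul ((√3 : ℂ) / 2)).add_const ((Real.pi : ℂ) / 6)
  have hv : HasDerivAt (fun w : ℂ => (√3 : ℂ) * w + Real.pi / 3) (√3 : ℂ) w := by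
    simpa using ((hasDerivAt_id w).const_mul (√3 : ℂ)).add_const ((Real.pi : ℂ) / 3)
  have h : HasDerivAt leafEGF _ w :=
    (((hv.csin.const_mul ((√3 : ℂ) / 6)).add ((hasDerivAt_id w).div_const 2)).sub_const
    (1 / 4)).div (hu.ccos.pow 2) (pow_ne_zero 2 hw)
  convert h using 1
  have h2 : (√3 : ℂ) * w + Real.pi / 3 = 2 * ((√3 : ℂ) / 2 * w + Real.pi / 6) := by ring
  simp only [treeEGF, leafEGF, h2, id, Pi.add_apply]
  generalize (√3 : ℂ) / 2 * w + Real.pi / 6 = u at hw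
  rw [Complex.cos_two_mul]
  generalize Complex.sin (2 * u) = s
  field_simp
  simp only [Nat.cast_ofNat, Nat.reduceSub, pow_one]
  linear_combination (-(16 * Complex.cos u ^ 2 * (2 * Complex.cos u ^ 2 - 1))) * sqrt_three_sq

theorem treeEGF_zero : treeEGF 0 = 0 := by
  have h : Complex.cos (Real.pi / 6) = ((√3 / 2 : ℝ) : ℂ) := by
    rw [← Real.cos_pi_div_six]; push_cast; rfl
  have h' : Complex.sin (Real.pi / 6) = ((1 / 2 : ℝ) : ℂ) := by
    rw [← Real.sin_pi_div_six]; push_cast; rfl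
  have h3 : (√3 : ℂ) ≠ 0 := by simp
  rw [treeEGF, mul_zero, zero_add, h, h']
  push_cast
  field_simp
  norm_num

theorem leafEGF_zero : leafEGF 0 = 0 := by
  have h : Complex.sin (Real.pi / 3) = ((√3 / 2 : ℝ) : ℂ) := by
    rw [← Real.sin_pi_div_three]; push_cast; rfl
  rw [leafEGF, mul_zero, zero_add, h]
  push_cast
  rw [div_eq_zero_iff]
  left
  linear_combination (1 / 12) * sqrt_three_sq

theorem radius_pos : 0 < 2 * Real.pi / (3 * √3) := by
  have := Real.pi_pos
  positivity

theorem differentiableOn_treeEGF :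
    DifferentiableOn ℂ treeEGF (Metric.ball 0 (2 * Real.pi / (3 * √3))) := fun w hw =>
  (hasDerivAt_treeEGF (cos_ne_zero_of_norm_lt
    (by simpa using hw))).differentiableAt.differentiableWithinAt

theorem differentiableOn_leafEGF :
    DifferentiableOn ℂ leafEGF (Metric.ball 0 (2 * Real.pi / (3 * √3))) := fun w hw =>
  (hasDerivAt_leafEGF (cos_ne_zero_of_norm_lt
    (by simpa using hw))).differentiableAt.differentiableWithinAt

theorem contDiffAt_treeEGF (n : ℕ) : ContDiffAt ℂ n treeEGF 0 :=
  (differentiableOn_treeEGF.analyticAt (Metric.ball_mem_nhds _ radius_pos)).contDiffAt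

theorem contDiffAt_leafEGF (n : ℕ) : ContDiffAt ℂ n leafEGF 0 :=
  (differentiableOn_leafEGF.analyticAt (Metric.ball_mem_nhds _ radius_pos)).contDiffAt

theorem iteratedDeriv_succ_treeEGF (n : ℕ) :
    iteratedDeriv (n + 1) treeEGF 0 = (Pi.single 0 1 : ℕ → ℂ) n + iteratedDeriv n treeEGF 0 +
      ∑ i ∈ range (n + 1), (n.choose i : ℂ) * iteratedDeriv i treeEGF 0 *
        iteratedDeriv (n - i) treeEGF 0 := by
  have hz := contDiffAt_treeEGF n
  have h : deriv treeEGF =ᶠ[nhds 0] fun w => 1 + treeEGF w + treeEGF w * treeEGF w := by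
    filter_upwards [Metric.ball_mem_nhds (0 : ℂ) radius_pos] with w hw
    exact (hasDerivAt_treeEGF (cos_ne_zero_of_norm_lt (by simpa using hw))).deriv
  rw [iteratedDeriv_succ', h.iteratedDeriv_eq,
    iteratedDeriv_fun_add (contDiffAt_const.add hz) (hz.mul hz),
    iteratedDeriv_fun_add contDiffAt_const hz, iteratedDeriv_fun_mul hz hz, iteratedDeriv_const,
    Pi.single_apply]

theorem iteratedDeriv_succ_leafEGF (n : ℕ) :
    iteratedDeriv (n + 1) leafEGF 0 = (Pi.single 0 1 : ℕ → ℂ) n + iteratedDeriv n leafEGF 0 +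
      ∑ i ∈ range (n + 1), (n.choose i : ℂ) * iteratedDeriv i leafEGF 0 *
        iteratedDeriv (n - i) treeEGF 0 +
      ∑ i ∈ range (n + 1), (n.choose i : ℂ) * iteratedDeriv i treeEGF 0 *
        iteratedDeriv (n - i) leafEGF 0 := by
  have hz := contDiffAt_treeEGF n
  have hd := contDiffAt_leafEGF n
  have h : deriv leafEGF =ᶠ[nhds 0]
      fun w => 1 + leafEGF w + leafEGF w * treeEGF w + treeEGF w * leafEGF w := by
    filter_upwards [Metric.ball_mem_nhds (0 : ℂ) radius_pos] with w hw
    exact (hasDerivAt_leafEGF (cos_ne_zero_of_norm_lt (by simpa using hw))).deriv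
  rw [iteratedDeriv_succ', h.iteratedDeriv_eq,
    iteratedDeriv_fun_add ((contDiffAt_const.add hd).add (hd.mul hz)) (hz.mul hd),
    iteratedDeriv_fun_add (contDiffAt_const.add hd) (hd.mul hz),
    iteratedDeriv_fun_add contDiffAt_const hd, iteratedDeriv_fun_mul hd hz,
    iteratedDeriv_fun_mul hz hd, iteratedDeriv_const, Pi.single_apply]

theorem iteratedDeriv_leafEGF (n : ℕ) : iteratedDeriv n leafEGF 0 = d n 0 := by
  rw [cast_d_zero_eq_treeSum, treeSum_leafWeight (a := fun n => iteratedDeriv n treeEGF 0)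
    (b := fun n => iteratedDeriv n leafEGF 0) (by simpa using treeEGF_zero)
    iteratedDeriv_succ_treeEGF (by simpa using leafEGF_zero) iteratedDeriv_succ_leafEGF,
    Nat.card_Icc, Nat.add_sub_cancel]

end BalancedTrees

open BalancedTrees

/-- For every real `x` with `|x| < 2π/(3√3)`, the series
`∑_{n≥1} d(n,0) xⁿ/n!` converges with sum
`((√3/6) sin(√3 x + π/3) + x/2 - 1/4) / cos²((√3/2)x + π/6)`, where `d(n,0)`
is the total number of leaves in all plane 1-2 trees on `{1,…,n}`. -/
theorem statement18 (x : ℝ) (hx : |x| < 2 * Real.pi / (3 * Real.sqrt 3)) :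
    HasSum
      (fun n : ℕ =>
        (d (n + 1) 0 : ℝ) * x ^ (n + 1) / (Nat.factorial (n + 1) : ℝ))
      ((Real.sqrt 3 / 6 * Real.sin (Real.sqrt 3 * x + Real.pi / 3) + x / 2 -
          1 / 4) /
        Real.cos (Real.sqrt 3 / 2 * x + Real.pi / 6) ^ 2) := by
  have h := Complex.hasSum_taylorSeries_on_ball differentiableOn_leafEGF (z := (x : ℂ))
    (by simpa using hx)
  rw [← hasSum_nat_add_iff' 1] at h
  rw [← Complex.hasSum_ofReal]
  have hterm : ∀ n : ℕ, (((d (n + 1) 0 : ℝ) * x ^ (n + 1) / ((n + 1).factorial : ℝ) : ℝ) : ℂ) =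
      ((n + 1).factorial : ℂ)⁻¹ • ((x : ℂ) - 0) ^ (n + 1) • iteratedDeriv (n + 1) leafEGF 0 := by
    intro n
    rw [iteratedDeriv_leafEGF, sub_zero, smul_eq_mul, smul_eq_mul]
    push_cast
    ring
  simp only [Finset.sum_range_one, iteratedDeriv_zero, leafEGF_zero, smul_zero,
    sub_zero] at h hterm
  simp only [hterm]
  push_cast
  exact h
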